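/- Fix δ > 0, β > 0 and γ ∈ (0, 1]. For every binary qubit POVM in conical coordinates (w, λ, θ, φ) with purity 2(1 + λ²)w² = γ, the Fisher information satisfies F_β ≤ δ² √γ e^{2βδ} / ((1 + e^{βδ})² (1 + e^{βδ} − √γ)), and equality holds for the semiclassical POVM with λ = 1, θ = 0 and w = √γ/2. -/

import Mathlib

open Matrix ComplexOrder Real

noncomputable def pauliX : Matrix (Fin 2) (Fin 2) ℂ := !![0, 1; 1, 0]
noncomputable def pauliY : Matrix (Fin 2) (Fin 2) ℂ := !![0, -Complex.I; Complex.I, 0]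
noncomputable def pauliZ : Matrix (Fin 2) (Fin 2) ℂ := !![1, 0; 0, -1]

/-- The thermal qubit state `ρ_β = diag(e^{−βδ/2}, e^{βδ/2})/(2 cosh(βδ/2))`. -/
noncomputable def rhoTherm (δ β : ℝ) : Matrix (Fin 2) (Fin 2) ℂ :=
  ((2 * Real.cosh (β * δ / 2) : ℝ)⁻¹ : ℂ) •
    !![Complex.exp (-(β * δ / 2)), 0; 0, Complex.exp (β * δ / 2)]

/-- The POVM element `Π₀` of a binary qubit POVM in conical coordinates. -/
noncomputable def povm0 (w l θ φ : ℝ) : Matrix (Fin 2) (Fin 2) ℂ :=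
  (w : ℂ) • ((1 : Matrix (Fin 2) (Fin 2) ℂ)
    + ((l * Real.sin θ * Real.cos φ : ℝ) : ℂ) • pauliX
    + ((l * Real.sin θ * Real.sin φ : ℝ) : ℂ) • pauliY
    + ((l * Real.cos θ : ℝ) : ℂ) • pauliZ)

/-- The POVM element `Π₁ = I₂ − Π₀`. -/
noncomputable def povm1 (w l θ φ : ℝ) : Matrix (Fin 2) (Fin 2) ℂ :=
  1 - povm0 w l θ φ

/-- The outcome probability `p₀(β) = tr(ρ_β Π₀)`. -/
noncomputable def prob0 (δ β w l θ φ : ℝ) : ℝ :=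
  ((rhoTherm δ β * povm0 w l θ φ).trace).re

/-- The Fisher information of the measurement, `F_β = (dp₀/dβ)²/(p₀ p₁)`. -/
noncomputable def fisherInfo (δ β w l θ φ : ℝ) : ℝ :=
  (deriv (fun b => prob0 δ b w l θ φ) β) ^ 2 /
    (prob0 δ β w l θ φ * (1 - prob0 δ β w l θ φ))

theorem prob0_eq (δ b w l θ φ : ℝ) :
    prob0 δ b w l θ φ = w * (1 - l * Real.cos θ * (1 - 2 / (1 + Real.exp (b * δ)))) := by
  have h1 : Complex.exp (-(b * δ / 2)) = ((Real.exp (-(b * δ / 2)) : ℝ) : ℂ) := by push_cast; rfl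
  have h2 : Complex.exp (b * δ / 2) = ((Real.exp (b * δ / 2) : ℝ) : ℂ) := by push_cast; rfl
  have h3 : prob0 δ b w l θ φ = (2 * Real.cosh (b * δ / 2))⁻¹ *
      (Real.exp (-(b * δ / 2)) * (w * (1 + l * Real.cos θ))
        + Real.exp (b * δ / 2) * (w * (1 - l * Real.cos θ))) := by
    rw [prob0, rhoTherm, povm0, h1, h2, ← Complex.ofReal_inv, smul_mul_assoc, trace_smul,
      smul_eq_mul, Complex.re_ofReal_mul]
    congr 1
    simp only [pauliX, pauliY, pauliZ, Matrix.trace_fin_two, Matrix.mul_apply, Fin.sum_univ_two,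
      Matrix.smul_apply, Matrix.add_apply, Matrix.one_apply, Matrix.of_apply, Matrix.cons_val',
      Matrix.cons_val_zero, Matrix.cons_val_one, Matrix.cons_val_fin_one, smul_eq_mul]
    simp [-Complex.ofReal_exp, -Complex.ofReal_cos, -Complex.ofReal_sin, ← sub_eq_add_neg]
  have hE : Real.exp (b * δ) = Real.exp (b * δ / 2) ^ 2 := by
    rw [← Real.exp_nat_mul]; congr 1; push_cast; ring
  have hpos := Real.exp_pos (b * δ / 2)
  rw [h3, Real.cosh_eq, hE, Real.exp_neg]
  field_simp
  ring

theorem deriv_prob0 (δ β w l θ φ : ℝ) :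
    deriv (fun b => prob0 δ b w l θ φ) β =
      -(2 * w * (l * Real.cos θ) * δ * Real.exp (β * δ) / (1 + Real.exp (β * δ)) ^ 2) := by
  have hE : 1 + Real.exp (β * δ) ≠ 0 := by positivity
  have h1 : HasDerivAt (fun b : ℝ => 1 + Real.exp (b * δ)) (Real.exp (β * δ) * (1 * δ)) β :=
    (((hasDerivAt_id β).mul_const δ).exp).const_add 1
  have h2 := ((((((hasDerivAt_const β (2 : ℝ)).div h1 hE).const_sub 1).const_mul
    (l * Real.cos θ)).const_sub 1).const_mul w)
  have h3 : (fun b => prob0 δ b w l θ φ) =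
      fun b => w * (1 - l * Real.cos θ * (1 - 2 / (1 + Real.exp (b * δ)))) :=
    funext fun b => prob0_eq δ b w l θ φ
  rw [h3]
  refine h2.deriv.trans ?_
  field_simp
  ring

/-- With `x = λ cos θ` and `t = tanh (βδ/2)`, the cross-multiplied form of the bound. -/
theorem cross_bound {w x s t : ℝ} (hw : 0 < w) (hw' : w ≤ 1 / 2) (hx : |x| ≤ 1)
    (hs : 0 < s) (hs' : s ≤ 1) (ht : 0 ≤ t) (ht' : t < 1) (hws : w * (1 + |x|) ≤ s) :
    w * x ^ 2 * ((1 - t) * (2 - s * (1 - t))) ≤ s * ((1 - x * t) * (1 - w * (1 - x * t))) := by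
  have hX := abs_nonneg x
  have hxX := le_abs_self x
  have hxX' := neg_abs_le x
  rw [← sq_abs x]
  set X := |x|
  have step1 : (1 - X * t) * (1 - w * (1 - X * t)) ≤ (1 - x * t) * (1 - w * (1 - x * t)) := by
    have h : 0 ≤ (X - x) * t * (1 - w * (2 - (X + x) * t)) := by
      refine mul_nonneg (mul_nonneg (by linarith) ht) ?_
      have : 0 ≤ w * ((X + x) * t) := mul_nonneg hw.le (mul_nonneg (by linarith) ht)
      linarith
    linarith
  have hs2 : 0 ≤ 2 - s * (1 - t) := by nlinarith
  have step2 : w * X * (2 - s * (1 - t)) ≤ s * (1 - w * (1 - X * t)) := by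
    have h1 : w * (1 + X) * (2 * X + s * (1 - X)) ≤ s * (1 + X) := by
      have h2 : 2 * X + s * (1 - X) ≤ 1 + X := by nlinarith
      exact mul_le_mul hws h2 (by nlinarith) hs.le
    have h3 : w * (2 * X + s * (1 - X)) ≤ s := by
      by_contra! h
      nlinarith
    linarith
  have step3 : X * (1 - t) ≤ 1 - X * t := by linarith
  have hXt : 0 ≤ X * (1 - t) := mul_nonneg hX (by linarith)
  calc w * X ^ 2 * ((1 - t) * (2 - s * (1 - t)))
      = X * (1 - t) * (w * X * (2 - s * (1 - t))) := by ring
    _ ≤ (1 - X * t) * (s * (1 - w * (1 - X * t))) :=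
        mul_le_mul step3 step2 (by positivity) (hXt.trans step3)
    _ = s * ((1 - X * t) * (1 - w * (1 - X * t))) := by ring
    _ ≤ _ := mul_le_mul_of_nonneg_left step1 hs.le

theorem fisherInfo_eq (δ β w l θ φ : ℝ) (hw : w ≠ 0) :
    fisherInfo δ β w l θ φ =
      4 * δ ^ 2 * Real.exp (β * δ) ^ 2 / (1 + Real.exp (β * δ)) ^ 4 *
        (w * (l * Real.cos θ) ^ 2 /
          ((1 - l * Real.cos θ * (1 - 2 / (1 + Real.exp (β * δ)))) *
            (1 - w * (1 - l * Real.cos θ * (1 - 2 / (1 + Real.exp (β * δ))))))) := by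
  have hE : 1 + Real.exp (β * δ) ≠ 0 := by positivity
  rw [fisherInfo, deriv_prob0, prob0_eq]
  generalize 1 - l * Real.cos θ * (1 - 2 / (1 + Real.exp (β * δ))) = u
  rw [show w * u * (1 - w * u) = w * (u * (1 - w * u)) by ring]
  generalize u * (1 - w * u) = D
  rcases eq_or_ne D 0 with rfl | hD
  · simp
  · field_simp
    ring

theorem bound_eq (δ β : ℝ) {s : ℝ} (hs' : s ≤ 1) :
    δ ^ 2 * s * Real.exp (2 * β * δ) /
        ((1 + Real.exp (β * δ)) ^ 2 * (1 + Real.exp (β * δ) - s)) =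
      4 * δ ^ 2 * Real.exp (β * δ) ^ 2 / (1 + Real.exp (β * δ)) ^ 4 *
        (s / ((1 - (1 - 2 / (1 + Real.exp (β * δ)))) *
          (2 - s * (1 - (1 - 2 / (1 + Real.exp (β * δ))))))) := by
  have hE2 : Real.exp (2 * β * δ) = Real.exp (β * δ) ^ 2 := by
    rw [← Real.exp_nat_mul]; congr 1; push_cast; ring
  have hpos := Real.exp_pos (β * δ)
  rw [hE2, sub_sub_cancel]
  generalize Real.exp (β * δ) = E at *
  have h1 : 1 + E ≠ 0 := by positivity
  have h2 : 1 + E - s ≠ 0 := by linarith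
  have h3 : 2 - s * (2 / (1 + E)) = 2 * (1 + E - s) / (1 + E) := by
    field_simp
  rw [h3]
  field_simp
  ring

/-- For fixed purity `γ = 2(1+λ²)w²`, the Fisher information is maximized by the
semiclassical POVM with `λ = 1`, `θ = 0`, `w = √γ/2`. -/
theorem stmt4 (δ β γ : ℝ) (hδ : 0 < δ) (hβ : 0 < β) (hγ : 0 < γ) (hγ' : γ ≤ 1) :
    (∀ w l θ φ : ℝ, 0 < w → w ≤ 1 / 2 → 0 ≤ l → l ≤ 1 →
      0 ≤ θ → θ ≤ π → 0 ≤ φ → φ < 2 * π → 2 * (1 + l ^ 2) * w ^ 2 = γ →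
      fisherInfo δ β w l θ φ ≤
        δ ^ 2 * Real.sqrt γ * Real.exp (2 * β * δ) /
          ((1 + Real.exp (β * δ)) ^ 2 * (1 + Real.exp (β * δ) - Real.sqrt γ)))
    ∧ (∀ φ : ℝ, 0 ≤ φ → φ < 2 * π →
      fisherInfo δ β (Real.sqrt γ / 2) 1 0 φ =
        δ ^ 2 * Real.sqrt γ * Real.exp (2 * β * δ) /
          ((1 + Real.exp (β * δ)) ^ 2 * (1 + Real.exp (β * δ) - Real.sqrt γ))) := by
  have hs : 0 < √γ := Real.sqrt_pos.mpr hγ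
  have hs' : √γ ≤ 1 := Real.sqrt_le_one.mpr hγ'
  have hE : 1 < Real.exp (β * δ) := Real.one_lt_exp_iff.mpr (mul_pos hβ hδ)
  have ht : 0 ≤ 1 - 2 / (1 + Real.exp (β * δ)) := by
    rw [sub_nonneg, div_le_one (by linarith)]
    linarith
  have ht' : 1 - 2 / (1 + Real.exp (β * δ)) < 1 := by
    rw [sub_lt_self_iff]
    positivity
  constructor
  · intro w l θ φ hw hw' hl hl' _ _ _ _ hpur
    have habs : |l * Real.cos θ| ≤ l := by
      rw [abs_mul, abs_of_nonneg hl]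
      exact mul_le_of_le_one_right hl (Real.abs_cos_le_one θ)
    have hws : w * (1 + |l * Real.cos θ|) ≤ √γ := by
      refine (mul_le_mul_of_nonneg_left (add_le_add_right habs 1) hw.le).trans ?_
      apply Real.le_sqrt_of_sq_le
      nlinarith [mul_nonneg (sq_nonneg (1 - l)) (sq_nonneg w)]
    have key := cross_bound hw hw' (habs.trans hl') hs hs' ht ht' hws
    rw [fisherInfo_eq δ β w l θ φ hw.ne', bound_eq δ β hs']
    generalize 1 - 2 / (1 + Real.exp (β * δ)) = t at *
    have hxt : |l * Real.cos θ * t| < 1 := by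
      rw [abs_mul, abs_of_nonneg ht]
      nlinarith [abs_nonneg (l * Real.cos θ)]
    obtain ⟨hxt1, hxt2⟩ := abs_lt.mp hxt
    refine mul_le_mul_of_nonneg_left ?_ (by positivity)
    have h1 : 0 < 1 - l * Real.cos θ * t := by linarith
    have h2 : 0 < 1 - w * (1 - l * Real.cos θ * t) := by nlinarith
    have h3 : 0 < 1 - t := by linarith
    have h4 : 0 < 2 - √γ * (1 - t) := by nlinarith
    rw [div_le_div_iff₀ (mul_pos h1 h2) (mul_pos h3 h4)]
    exact key
  · intro φ _ _
    rw [fisherInfo_eq δ β (√γ / 2) 1 0 φ (by positivity), bound_eq δ β hs']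
    generalize 1 - 2 / (1 + Real.exp (β * δ)) = t at *
    have h3 : 1 - t ≠ 0 := by linarith
    have h4 : 2 - √γ * (1 - t) ≠ 0 := by nlinarith
    have h5 : 1 - √γ / 2 * (1 - t) = (2 - √γ * (1 - t)) / 2 := by ring
    simp only [Real.cos_zero, mul_one, one_mul, one_pow, h5]
    field_simp
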